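/- arXiv:2107.01147 — 2 statements merged into one kernel-verified Lean document; each statement's English description precedes it below -/
import Mathlib

section
/- Let C be a division Cayley algebra over a field F with norm n, let K be a 2-dimensional composition subalgebra of C (i.e. n restricted to K is regular), let x ∈ C, and let φ be a local automorphism of C. Then there exists an automorphism ψ of C with ψ|_K = φ|_K and ψ(x) = φ(x). -/
open QuadraticMap

namespace CayleyAux

set_option linter.unusedSectionVars false

variable {F : Type*} [Field F] {C : Type*}
    [NonAssocRing C] [Module F C] [SMulCommClass F C C] [IsScalarTower F C C]

structure Comp (n : QuadraticForm F C) : Prop where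
  comp : ∀ x y : C, n (x * y) = n x * n y
  nd : ∀ x : C, (∀ y : C, polar (⇑n) x y = 0) → x = 0
  aniso : ∀ x : C, n x = 0 → x = 0
  one : n 1 = 1

/-- conjugation -/
def cj (n : QuadraticForm F C) (x : C) : C := polar (⇑n) x 1 • (1 : C) - x

variable {n : QuadraticForm F C}

theorem Comp.ext (H : Comp n) {x y : C} (h : ∀ z, polar n x z = polar n y z) : x = y := by
  rw [← sub_eq_zero]
  apply H.nd
  intro z
  rw [polar_sub_left, h, sub_self]

theorem Comp.polar_left (H : Comp n) (x y w : C) :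
    polar n (x * y) (x * w) = n x * polar n y w := by
  simp only [polar, ← mul_add, H.comp]; ring

theorem Comp.polar_right (H : Comp n) (x y w : C) :
    polar n (y * x) (w * x) = polar n y w * n x := by
  simp only [polar, ← add_mul, H.comp]; ring

theorem Comp.polar_four (H : Comp n) (x w y v : C) :
    polar n (x * y) (w * v) + polar n (w * y) (x * v) = polar n x w * polar n y v := by
  have h := H.polar_left (x + w) y v
  have h1 := H.polar_left x y v
  have h2 := H.polar_left w y v
  have h3 : n (x + w) = n x + n w + polar n x w := by simp [polar]
  rw [h3] at h
  simp only [add_mul, polar_add_left, polar_add_right] at h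
  linear_combination h - h1 - h2

theorem Comp.adj_left (H : Comp n) (x y w : C) :
    polar n (x * y) w = polar n y (cj n x * w) := by
  have h := H.polar_four x 1 y w
  simp only [one_mul] at h
  simp only [cj, sub_mul, smul_mul_assoc, one_mul, polar_sub_right, polar_smul_right, smul_eq_mul]
  linear_combination h

theorem Comp.adj_right (H : Comp n) (x y w : C) :
    polar n (x * y) w = polar n x (w * cj n y) := by
  have h := H.polar_four x w y 1
  simp only [mul_one] at h
  simp only [cj, mul_sub, mul_smul_comm, mul_one, polar_sub_right, polar_smul_right, smul_eq_mul]
  rw [polar_comm n (w * y)] at h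
  linear_combination h

theorem Comp.polar_one_one (H : Comp n) : polar n (1 : C) 1 = 2 := by
  rw [polar_self, H.one]; simp

theorem Comp.cj_cj (H : Comp n) (x : C) : cj n (cj n x) = x := by
  simp only [cj, polar_sub_left, polar_smul_left, H.polar_one_one, smul_eq_mul]
  module

theorem cj_add (x y : C) : cj n (x + y) = cj n x + cj n y := by
  simp only [cj, polar_add_left]; module

theorem Comp.cj_mul_mul (H : Comp n) (x w : C) : cj n x * (x * w) = n x • w := by
  apply H.ext
  intro z
  rw [polar_comm, ← H.adj_left, H.polar_left, polar_smul_left, polar_comm n z, smul_eq_mul]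

theorem Comp.mul_mul_cj (H : Comp n) (x w : C) : (w * x) * cj n x = n x • w := by
  apply H.ext
  intro z
  rw [polar_comm, ← H.adj_right, H.polar_right, polar_smul_left, polar_comm n z, smul_eq_mul,
    mul_comm]

theorem Comp.sq (H : Comp n) (x : C) : x * x = polar n x 1 • x - n x • 1 := by
  have := H.cj_mul_mul x 1
  simp only [cj, mul_one, sub_mul, smul_mul_assoc, one_mul] at this
  rw [← this]; abel

theorem Comp.lin_left (H : Comp n) (x y w : C) :
    cj n x * (y * w) + cj n y * (x * w) = polar n x y • w := by
  have h := H.cj_mul_mul (x + y) w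
  have h3 : n (x + y) = n x + n y + polar n x y := by simp [polar]
  rw [h3, cj_add] at h
  simp only [add_mul, mul_add, H.cj_mul_mul, add_smul] at h
  rw [← sub_eq_zero] at h ⊢
  rw [← h]; abel

theorem Comp.lin_right (H : Comp n) (x y w : C) :
    (w * y) * cj n x + (w * x) * cj n y = polar n x y • w := by
  have h := H.mul_mul_cj (x + y) w
  have h3 : n (x + y) = n x + n y + polar n x y := by simp [polar]
  rw [h3, cj_add] at h
  simp only [add_mul, mul_add, H.mul_mul_cj, add_smul] at h
  rw [← sub_eq_zero] at h ⊢
  rw [← h]; abel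

theorem Comp.cj_polar (H : Comp n) (x y : C) : polar n (cj n x) (cj n y) = polar n x y := by
  simp only [cj, polar_sub_left, polar_sub_right, polar_smul_left, polar_smul_right,
    H.polar_one_one, smul_eq_mul, polar_comm n 1 y]
  ring

theorem Comp.cj_mul (H : Comp n) (x y : C) : cj n (x * y) = cj n y * cj n x := by
  apply H.ext
  intro w
  have e1 : ∀ a b : C, polar n (cj n a) b = polar n a (cj n b) := fun a b => by
    rw [← H.cj_polar, H.cj_cj]
  rw [e1 (x * y) w, H.adj_left (cj n y), H.cj_cj, polar_comm n (cj n x), H.adj_right y w,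
    polar_comm n y, H.adj_left (cj n x), H.cj_cj, polar_comm]

/-- z orthogonal to 1 -/
theorem cj_of_orth {z : C} (h : polar n z 1 = 0) : cj n z = -z := by
  simp [cj, h]

theorem Comp.swap_left (H : Comp n) {z a : C} (h1 : polar n z 1 = 0) (ha : polar n z a = 0) (w : C) :
    a * (z * w) = z * (cj n a * w) := by
  have h := H.lin_left (cj n a) z w
  have e : polar n (cj n a) z = 0 := by
    rw [polar_comm, cj, polar_sub_right, polar_smul_right, h1, ha]; simp
  rw [H.cj_cj, cj_of_orth h1, e, zero_smul, neg_mul, ← sub_eq_add_neg, sub_eq_zero] at h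
  exact h

theorem Comp.swap_right (H : Comp n) {z a : C} (h1 : polar n z 1 = 0) (ha : polar n z a = 0) (w : C) :
    (w * z) * a = (w * cj n a) * z := by
  have h := H.lin_right (cj n a) z w
  have e : polar n (cj n a) z = 0 := by
    rw [polar_comm, cj, polar_sub_right, polar_smul_right, h1, ha]; simp
  rw [H.cj_cj, cj_of_orth h1, e, zero_smul, mul_neg, ← sub_eq_add_neg, sub_eq_zero] at h
  exact h

theorem Comp.comm_z (H : Comp n) {z a : C} (h1 : polar n z 1 = 0) (ha : polar n z a = 0) :
    a * z = z * cj n a := by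
  have := H.swap_left h1 ha 1
  simpa using this

theorem orth_cj {z a : C} (h1 : polar n z 1 = 0) (ha : polar n z a = 0) : polar n z (cj n a) = 0 := by
  rw [cj, polar_sub_right, polar_smul_right, h1, ha]; simp

theorem Comp.dbl1 (H : Comp n) {z a b : C} (h1 : polar n z 1 = 0) (ha : polar n z a = 0)
    (hb : polar n z b = 0) (hba : polar n z (b * a) = 0) : a * (b * z) = (b * a) * z := by
  rw [H.comm_z h1 hb, H.swap_left h1 ha, H.comm_z h1 hba, H.cj_mul]

theorem Comp.dbl3 (H : Comp n) {z a b : C} (h1 : polar n z 1 = 0) (ha : polar n z a = 0)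
    (hba : polar n z (b * a) = 0) : (a * z) * (b * z) = - n z • (cj n b * a) := by
  have h := H.lin_left (a * z) (cj n b) (z)
  have e0 : polar n (a * z) 1 = 0 := by
    rw [H.adj_left, mul_one]; exact orth_cj h1 ha
  have e1 : polar n (a * z) (cj n b) = 0 := by
    rw [H.adj_left, ← H.cj_mul]; exact orth_cj h1 hba
  have h' := H.lin_left (cj n (a * z)) b z
  have e2 : polar n (cj n (a * z)) b = 0 := by
    rw [← H.cj_polar, H.cj_cj]; exact e1
  have e3 : (a * z) * z = - n z • a := by
    have := H.mul_mul_cj z a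
    rw [cj_of_orth h1, mul_neg] at this
    rw [neg_smul, ← this, neg_neg]
  rw [H.cj_cj, e2, zero_smul, cj_of_orth e0, neg_mul, mul_neg, e3, mul_smul_comm] at h'
  rw [← sub_eq_zero, ← h']; abel

theorem Comp.dbl (H : Comp n) (A : Submodule F C) (h1 : (1 : C) ∈ A)
    (hmul : ∀ x ∈ A, ∀ y ∈ A, x * y ∈ A) (τ : C →ₗ[F] C)
    (z : C) (hz : ∀ a ∈ A, polar n z a = 0)
    (τmul : ∀ x ∈ A, ∀ y ∈ A, τ (x * y) = τ x * τ y) (τone : τ 1 = 1)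
    (τtr : ∀ a ∈ A, polar n (τ a) 1 = polar n a 1)
    (z' : C) (hz' : ∀ a ∈ A, polar n z' (τ a) = 0) (hn : n z' = n z)
    (hτz : ∀ a ∈ A, τ (a * z) = τ a * z')
    (a b c d : C) (ha : a ∈ A) (hb : b ∈ A) (hc : c ∈ A) (hd : d ∈ A) :
    τ ((a + b * z) * (c + d * z)) = τ (a + b * z) * τ (c + d * z) ∧
    (a + b * z) * (c + d * z) = (a * c - n z • (cj n d * b)) + (d * a + b * cj n c) * z := by
  have hcj : ∀ a ∈ A, cj n a ∈ A := fun a ha => A.sub_mem (A.smul_mem _ h1) ha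
  have τcj : ∀ a ∈ A, τ (cj n a) = cj n (τ a) := fun a ha => by
    simp only [cj, map_sub, map_smul, τone, τtr a ha]
  have z1 := hz 1 h1
  have z1' : polar n z' 1 = 0 := by rw [← τone]; exact hz' 1 h1
  have key : (a + b * z) * (c + d * z)
      = (a * c - n z • (cj n d * b)) + (d * a + b * cj n c) * z := by
    rw [add_mul, mul_add, mul_add, H.dbl1 z1 (hz a ha) (hz d hd) (hz _ (hmul d hd a ha)),
      H.swap_right z1 (hz c hc), H.dbl3 z1 (hz b hb) (hz _ (hmul d hd b hb)), add_mul, neg_smul]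
    abel
  refine ⟨?_, key⟩
  rw [key]
  simp only [map_add, map_sub, map_smul]
  rw [hτz _ hb, hτz _ hd, hτz _ (A.add_mem (hmul _ hd _ ha) (hmul _ hb _ (hcj _ hc)))]
  rw [map_add, τmul _ ha _ hc, τmul _ hd _ ha, τmul _ hb _ (hcj _ hc), τmul _ (hcj _ hd) _ hb,
    τcj _ hc, τcj _ hd]
  have o1 : polar n z' (τ d * τ a) = 0 := by rw [← τmul _ hd _ ha]; exact hz' _ (hmul _ hd _ ha)
  have o2 : polar n z' (τ d * τ b) = 0 := by rw [← τmul _ hd _ hb]; exact hz' _ (hmul _ hd _ hb)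
  rw [add_mul, add_mul, mul_add, mul_add, H.dbl1 z1' (hz' a ha) (hz' d hd) o1,
    H.swap_right z1' (hz' c hc), H.dbl3 z1' (hz' b hb) o2, neg_smul, hn]
  abel

theorem Comp.orth_mul (H : Comp n) (A : Submodule F C) (h1 : (1 : C) ∈ A)
    (hmul : ∀ x ∈ A, ∀ y ∈ A, x * y ∈ A)
    (z : C) (hz : ∀ a ∈ A, polar n z a = 0) (b c : C) (hb : b ∈ A) (hc : c ∈ A) :
    polar n (b * z) c = 0 := by
  rw [H.adj_left]
  exact hz _ (hmul _ (A.sub_mem (A.smul_mem _ h1) hb) _ hc)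

/-- the doubling map -/
def dmap (A : Submodule F C) (τ : C →ₗ[F] C) (z : C) : (A × A) →ₗ[F] C :=
  (τ ∘ₗ A.subtype).coprod ((LinearMap.mulRight F z) ∘ₗ τ ∘ₗ A.subtype)

@[simp] theorem dmap_apply (A : Submodule F C) (τ : C →ₗ[F] C) (z : C) (p : A × A) :
    dmap A τ z p = τ p.1 + τ p.2 * z := by
  simp [dmap]

theorem Comp.norm_mul_ne (H : Comp n) {b z : C} (hz : z ≠ 0) (h : b * z = 0) : b = 0 := by
  have : n b * n z = 0 := by rw [← H.comp, h, QuadraticMap.map_zero]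
  rcases mul_eq_zero.1 this with h | h
  · exact H.aniso _ h
  · exact absurd (H.aniso _ h) hz

theorem Comp.dmap_inj (H : Comp n) (A : Submodule F C) (h1 : (1 : C) ∈ A)
    (hmul : ∀ x ∈ A, ∀ y ∈ A, x * y ∈ A)
    (hreg : ∀ x ∈ A, (∀ y ∈ A, polar (⇑n) x y = 0) → x = 0)
    (τ : C →ₗ[F] C) (z z' : C) (hz : z ≠ 0) (hz0 : ∀ a ∈ A, polar n z a = 0)
    (hp : ∀ a b, polar n (τ a) (τ b) = polar n a b) (τone : τ 1 = 1)
    (τmul : ∀ x ∈ A, ∀ y ∈ A, τ (x * y) = τ x * τ y) (τi : ∀ a, τ a = 0 → a = 0)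
    (hz' : z' = τ z) :
    Function.Injective (dmap A τ z') := by
  rw [← LinearMap.ker_eq_bot, LinearMap.ker_eq_bot']
  rintro ⟨⟨a, ha⟩, ⟨b, hb⟩⟩ h
  simp only [dmap_apply] at h
  have hcj : ∀ a ∈ A, cj n a ∈ A := fun a ha => A.sub_mem (A.smul_mem _ h1) ha
  have τcj : ∀ a ∈ A, τ (cj n a) = cj n (τ a) := fun a ha => by
    rw [cj, cj, map_sub, map_smul, τone, ← hp a 1, τone]
  have ha0 : a = 0 := by
    apply hreg a ha
    intro c hc
    have : polar n (τ a + τ b * z') (τ c) = 0 := by rw [h, polar_zero_left]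
    rw [polar_add_left, H.adj_left, ← τcj _ hb, ← τmul _ (hcj _ hb) _ hc, hz', hp, hp,
      hz0 _ (hmul _ (hcj _ hb) _ hc), add_zero] at this
    exact this
  subst ha0
  rw [map_zero, zero_add] at h
  have : τ b = 0 := H.norm_mul_ne (fun h0 => hz (τi _ (by rw [← hz', h0]))) h
  simp [Prod.ext_iff, τi b this]

theorem exists_orth [FiniteDimensional F C] (n : QuadraticForm F C) (A : Submodule F C)
    (h : Module.finrank F A < Module.finrank F C) : ∃ z : C, z ≠ 0 ∧ ∀ a ∈ A, polar n z a = 0 := by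
  let f : C →ₗ[F] Module.Dual F A := (Module.Dual.transpose (R := F) A.subtype) ∘ₗ n.polarBilin
  have hk : LinearMap.ker f ≠ ⊥ := by
    apply LinearMap.ker_ne_bot_of_finrank_lt
    rwa [Subspace.dual_finrank_eq]
  obtain ⟨z, hz, hz0⟩ := Submodule.exists_mem_ne_zero_of_ne_bot hk
  refine ⟨z, hz0, fun a ha => ?_⟩
  have := LinearMap.congr_fun (LinearMap.mem_ker.1 hz) ⟨a, ha⟩
  simpa [f, Module.Dual.transpose] using this

theorem exists_decomp [FiniteDimensional F C] (n : QuadraticForm F C) (A : Submodule F C)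
    (hreg : ∀ x ∈ A, (∀ y ∈ A, polar (⇑n) x y = 0) → x = 0) (x : C) :
    ∃ k ∈ A, ∀ a ∈ A, polar n (x - k) a = 0 := by
  let f : C →ₗ[F] Module.Dual F A := (Module.Dual.transpose (R := F) A.subtype) ∘ₗ n.polarBilin
  have hf : ∀ c (a : A), f c a = polar n c a := by
    intro c a; simp [f, Module.Dual.transpose]
  have hi : Function.Injective (f ∘ₗ A.subtype) := by
    rw [← LinearMap.ker_eq_bot, LinearMap.ker_eq_bot']
    rintro ⟨a, ha⟩ h
    have := hreg a ha (fun y hy => by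
      have := LinearMap.congr_fun h ⟨y, hy⟩
      rw [LinearMap.comp_apply, hf] at this
      exact this)
    simp [this]
  have hs := (LinearMap.injective_iff_surjective_of_finrank_eq_finrank
    (by rw [Subspace.dual_finrank_eq])).1 hi
  obtain ⟨k, hk⟩ := hs (f x)
  refine ⟨k, k.2, fun a ha => ?_⟩
  have := LinearMap.congr_fun hk ⟨a, ha⟩
  rw [LinearMap.comp_apply, hf, hf] at this
  rw [polar_sub_left, sub_eq_zero]; exact this.symm

/-- automorphisms preserve the norm -/
theorem Comp.aut_norm (H : Comp n) (ψ : C →ₗ[F] C) (hb : Function.Bijective ψ)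
    (hm : ∀ a b : C, ψ (a * b) = ψ a * ψ b) : ψ 1 = 1 ∧ ∀ x, n (ψ x) = n x := by
  have h1 : ψ 1 = 1 := by
    obtain ⟨e, he⟩ := hb.2 1
    have := hm 1 e
    rw [one_mul, he, mul_one] at this
    exact this.symm
  refine ⟨h1, fun x => ?_⟩
  have e1 := congrArg ψ (H.sq x)
  rw [hm, H.sq (ψ x), map_sub, map_smul, map_smul, h1] at e1
  have e2 : (polar n (ψ x) 1 - polar n x 1) • ψ x = (n (ψ x) - n x) • (1 : C) := by
    rw [sub_smul, sub_smul, ← sub_eq_zero]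
    rw [← sub_eq_zero] at e1
    rw [← e1]; abel
  by_cases ht : polar n (ψ x) 1 - polar n x 1 = 0
  · rw [ht, zero_smul] at e2
    have h10 : (1 : C) ≠ 0 := fun h => by
      have := H.one
      rw [h, QuadraticMap.map_zero] at this
      exact zero_ne_one this
    exact sub_eq_zero.1 ((smul_eq_zero.1 e2.symm).resolve_right h10)
  · have : ψ x = ψ (((polar n (ψ x) 1 - polar n x 1)⁻¹ * (n (ψ x) - n x)) • (1 : C)) := by
      rw [map_smul, h1, mul_smul, ← e2, smul_smul, inv_mul_cancel₀ ht, one_smul]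
    have h := hb.1 this
    have h' : ψ x = x := by
      rw [h, map_smul, h1]
    rw [h']

/-- reflection moving one vector to another of the same norm -/
theorem Comp.refl_exists (H : Comp n) (a b : C) (hab : n a = n b) :
    ∃ s : C →ₗ[F] C, s a = b ∧ (∀ x, n (s x) = n x) ∧
      ∀ w, polar n w a = polar n w b → s w = w := by
  by_cases h : a = b
  · exact ⟨LinearMap.id, h, fun _ => rfl, fun _ _ => rfl⟩
  have hv : n (a - b) ≠ 0 := fun h0 => h (sub_eq_zero.1 (H.aniso _ h0))
  let s : C →ₗ[F] C := LinearMap.id -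
    (n.polarBilin (a - b)).smulRight ((n (a - b))⁻¹ • (a - b))
  have hs : ∀ w, s w = w - (polar n w (a - b) * (n (a - b))⁻¹) • (a - b) := fun w => by
    simp only [s, LinearMap.sub_apply, LinearMap.id_apply, LinearMap.smulRight_apply, smul_smul,
      polarBilin_apply_apply, polar_comm n w]
  refine ⟨s, ?_, ?_, ?_⟩
  · have e : polar n a (a - b) = n (a - b) := by
      have h1 : n (a - b) = n a + n b - polar n a b := by
        have : polar n a (-b) = n (a - b) - n a - n (-b) := by simp [polar, sub_eq_add_neg]
        rw [polar_neg_right, QuadraticMap.map_neg] at this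
        linear_combination -this
      rw [h1, polar_sub_right, polar_self, ← hab]; simp; ring
    rw [hs, e, mul_inv_cancel₀ hv, one_smul]; abel
  · intro x
    rw [hs]
    set v := a - b
    set t := polar n x v * (n v)⁻¹ with ht
    have : polar n x (-(t • v)) = n (x - t • v) - n x - n (-(t • v)) := by
      simp [polar, sub_eq_add_neg]
    rw [polar_neg_right, QuadraticMap.map_neg, polar_smul_right, QuadraticMap.map_smul] at this
    have e : t * n v = polar n x v := by rw [ht, mul_assoc, inv_mul_cancel₀ hv, mul_one]
    simp only [smul_eq_mul] at this
    linear_combination -this + t * e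
  · intro w hw
    rw [hs, polar_sub_right, hw, sub_self]; simp

theorem span_two (K : Submodule F C) (hK1 : (1 : C) ∈ K) (h10 : (1 : C) ≠ 0)
    (hKdim : Module.finrank F K = 2) : ∃ u ∈ K, ∀ k ∈ K, ∃ r s : F, k = r • 1 + s • u := by
  have : FiniteDimensional F K := Module.finite_of_finrank_pos (by omega)
  have hlt : Module.finrank F (F ∙ (⟨1, hK1⟩ : K)) < Module.finrank F K := by
    rw [finrank_span_singleton (by simpa using h10)]; omega
  obtain ⟨u, hu⟩ : ∃ u : K, u ∉ (F ∙ (⟨1, hK1⟩ : K)) := by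
    by_contra! hc
    have : (F ∙ (⟨1, hK1⟩ : K)) = ⊤ := by ext; simp [hc]
    rw [this, finrank_top] at hlt
    exact lt_irrefl _ hlt
  refine ⟨u, u.2, fun k hk => ?_⟩
  have hli : LinearIndependent F ![(⟨1, hK1⟩ : K), u] := by
    rw [LinearIndependent.pair_iff' (by simpa using h10)]
    intro a ha
    exact hu (Submodule.mem_span_singleton.2 ⟨a, ha⟩)
  have htop := hli.span_eq_top_of_card_eq_finrank' (by simp [hKdim])
  have hm : (⟨k, hk⟩ : K) ∈ Submodule.span F (Set.range ![(⟨1, hK1⟩ : K), u]) := by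
    rw [htop]; trivial
  rw [Matrix.range_cons, Matrix.range_cons, Matrix.range_empty, Set.union_empty,
    Set.singleton_union, Submodule.mem_span_pair] at hm
  obtain ⟨r, s, h⟩ := hm
  exact ⟨r, s, by simpa using (congrArg Subtype.val h).symm⟩

/-- The main step. -/
theorem Comp.main (H : Comp n) [FiniteDimensional F C] (hdim : Module.finrank F C = 8)
    (K : Submodule F C) (hK1 : (1 : C) ∈ K)
    (hKmul : ∀ x ∈ K, ∀ y ∈ K, x * y ∈ K)
    (hKdim : Module.finrank F ↥K = 2)
    (hKreg : ∀ x ∈ K, (∀ y ∈ K, polar (⇑n) x y = 0) → x = 0)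
    (φ : C →ₗ[F] C) (φ1 : φ 1 = 1) (φn : ∀ x, n (φ x) = n x)
    (y : C) (hy0 : y ≠ 0) (hy : ∀ a ∈ K, polar n y a = 0) :
    ∃ ψ : C →ₗ[F] C,
      (Function.Bijective ψ ∧ ∀ a b : C, ψ (a * b) = ψ a * ψ b) ∧
      (∀ k ∈ K, ψ k = φ k) ∧ ψ y = φ y := by
  have h10 : (1 : C) ≠ 0 := fun h => by
    have := H.one
    rw [h, QuadraticMap.map_zero] at this
    exact zero_ne_one this
  have pol : ∀ (τ : C →ₗ[F] C), (∀ x, n (τ x) = n x) →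
      ∀ a b, polar n (τ a) (τ b) = polar n a b := fun τ h a b => by
    simp only [polar, ← map_add, h]
  have φp := pol φ φn
  obtain ⟨u, hu, hspan⟩ := span_two K hK1 h10 hKdim
  have y1 := hy 1 hK1
  have yu := hy u hu
  -- the isometry taking `u * y` to `φ u * φ y`
  obtain ⟨s, hs1, hsn, hsf⟩ := H.refl_exists (φ (u * y)) (φ u * φ y) (by
    rw [φn, H.comp, H.comp, φn, φn])
  let σ : C →ₗ[F] C := s ∘ₗ φ
  have σn : ∀ x, n (σ x) = n x := fun x => by simp [σ, hsn, φn]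
  have σp := pol σ σn
  have key : ∀ w, polar n w (u * y) = polar n (φ w) (φ u * φ y) → σ w = φ w := fun w hw =>
    hsf (φ w) (by rw [φp, hw])
  have y1' : polar n (φ y) 1 = 0 := by rw [← φ1, φp, y1]
  have yu' : polar n (φ y) (φ u) = 0 := by rw [φp, yu]
  have σ1 : σ 1 = 1 := by
    rw [key 1, φ1]
    rw [φ1, polar_comm, H.adj_left, polar_comm n 1, H.adj_left, mul_one, mul_one,
      orth_cj y1 yu, orth_cj y1' yu']
  have σu : σ u = φ u := by
    apply key
    have e1 := H.polar_left u 1 y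
    have e2 := H.polar_left (φ u) 1 (φ y)
    rw [mul_one, polar_comm n 1] at e1 e2
    rw [e1, e2, y1, y1']; simp
  have σy : σ y = φ y := by
    apply key
    have e1 := H.polar_right y 1 u
    have e2 := H.polar_right (φ y) 1 (φ u)
    rw [one_mul] at e1 e2
    rw [e1, e2, φn, ← φp 1 u, φ1]
  have σuy : σ (u * y) = σ u * σ y := by rw [σu, σy]; exact hs1
  have σK : ∀ k ∈ K, σ k = φ k := by
    intro k hk
    obtain ⟨r, t, rfl⟩ := hspan k hk
    simp only [map_add, map_smul, σ1, φ1, σu]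
  have σKy : ∀ k ∈ K, σ (k * y) = σ k * σ y := by
    intro k hk
    obtain ⟨r, t, rfl⟩ := hspan k hk
    simp only [map_add, map_smul, add_mul, smul_mul_assoc, σ1, σuy, one_mul]
  have σtr : ∀ a, polar n (σ a) 1 = polar n a 1 := fun a => by
    rw [← σp a 1, σ1]
  have σsq : ∀ a, σ (a * a) = σ a * σ a := fun a => by
    rw [H.sq a, H.sq (σ a), map_sub, map_smul, map_smul, σ1, σn, σtr]
  have σKmul : ∀ a ∈ K, ∀ b ∈ K, σ (a * b) = σ a * σ b := by
    intro a ha b hb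
    obtain ⟨r, t, rfl⟩ := hspan a ha
    obtain ⟨r', t', rfl⟩ := hspan b hb
    simp only [map_add, map_smul, add_mul, mul_add, smul_mul_assoc, mul_smul_comm, σ1, σsq, one_mul,
      mul_one]
  have σi : ∀ a, σ a = 0 → a = 0 := fun a h => H.aniso a (by rw [← σn, h, QuadraticMap.map_zero])
  -- first doubling
  have dK := H.dbl K hK1 hKmul σ y hy σKmul σ1 (fun a _ => σtr a) (σ y)
    (fun a _ => by rw [σp]; exact hy a ‹_›) (σn y) σKy
  have fi : Function.Injective (dmap K LinearMap.id y) :=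
    H.dmap_inj K hK1 hKmul hKreg LinearMap.id y y hy0 hy (fun _ _ => rfl) rfl
      (fun _ _ _ _ => rfl) (fun _ h => h) rfl
  obtain ⟨A, hA⟩ : ∃ A : Submodule F C, A = LinearMap.range (dmap K LinearMap.id y) := ⟨_, rfl⟩
  have memA : ∀ x, x ∈ A ↔ ∃ a ∈ K, ∃ b ∈ K, x = a + b * y := by
    intro x
    rw [hA, LinearMap.mem_range]
    constructor
    · rintro ⟨p, rfl⟩
      exact ⟨p.1, p.1.2, p.2, p.2.2, by simp⟩
    · rintro ⟨a, ha, b, hb, rfl⟩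
      exact ⟨(⟨a, ha⟩, ⟨b, hb⟩), by simp⟩
  have Adim : Module.finrank F A = 4 := by
    rw [hA, LinearMap.finrank_range_of_inj fi, Module.finrank_prod, hKdim]
  have KA : ∀ k ∈ K, k ∈ A := fun k hk => (memA k).2 ⟨k, hk, 0, K.zero_mem, by simp⟩
  have yA : y ∈ A := (memA y).2 ⟨0, K.zero_mem, 1, hK1, by simp⟩
  have hKcj : ∀ a ∈ K, cj n a ∈ K := fun a ha => K.sub_mem (K.smul_mem _ hK1) ha
  have Amul : ∀ x ∈ A, ∀ w ∈ A, x * w ∈ A := by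
    intro x hx w hw
    obtain ⟨a, ha, b, hb, rfl⟩ := (memA _).1 hx
    obtain ⟨c, hc, d, hd, rfl⟩ := (memA _).1 hw
    rw [(dK a b c d ha hb hc hd).2, memA]
    exact ⟨_, K.sub_mem (hKmul _ ha _ hc) (K.smul_mem _ (hKmul _ (hKcj _ hd) _ hb)), _,
      K.add_mem (hKmul _ hd _ ha) (hKmul _ hb _ (hKcj _ hc)), rfl⟩
  have σAmul : ∀ x ∈ A, ∀ w ∈ A, σ (x * w) = σ x * σ w := by
    intro x hx w hw
    obtain ⟨a, ha, b, hb, rfl⟩ := (memA _).1 hx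
    obtain ⟨c, hc, d, hd, rfl⟩ := (memA _).1 hw
    exact (dK a b c d ha hb hc hd).1
  have Areg : ∀ x ∈ A, (∀ w ∈ A, polar (⇑n) x w = 0) → x = 0 := by
    intro x hx h
    obtain ⟨a, ha, b, hb, rfl⟩ := (memA _).1 hx
    have ha0 : a = 0 := by
      apply hKreg a ha
      intro c hc
      have := h c (KA c hc)
      rwa [polar_add_left, H.orth_mul K hK1 hKmul y hy b c hb hc, add_zero] at this
    subst ha0
    have hb0 : b = 0 := by
      apply hKreg b hb
      intro c hc
      have := h (c * y) ((memA _).2 ⟨0, K.zero_mem, c, hc, by simp⟩)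
      rw [zero_add, H.polar_right] at this
      exact (mul_eq_zero.1 this).resolve_right (fun h => hy0 (H.aniso _ h))
    simp [hb0]
  -- second doubling
  have A1 := KA 1 hK1
  obtain ⟨z, hz0, hz⟩ := exists_orth n A (by omega)
  have gi : Function.Injective (dmap A LinearMap.id z) :=
    H.dmap_inj A A1 Amul Areg LinearMap.id z z hz0 hz (fun _ _ => rfl) rfl
      (fun _ _ _ _ => rfl) (fun _ h => h) rfl
  have gi' : Function.Injective (dmap A σ (σ z)) :=
    H.dmap_inj A A1 Amul Areg σ z (σ z) hz0 hz σp σ1 σAmul σi rfl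
  have hfr : Module.finrank F (A × A) = Module.finrank F C := by
    rw [Module.finrank_prod, Adim, hdim]
  let e : (A × A) ≃ₗ[F] C := LinearEquiv.ofBijective (dmap A LinearMap.id z)
    ⟨gi, (LinearMap.injective_iff_surjective_of_finrank_eq_finrank hfr).1 gi⟩
  let e' : (A × A) ≃ₗ[F] C := LinearEquiv.ofBijective (dmap A σ (σ z))
    ⟨gi', (LinearMap.injective_iff_surjective_of_finrank_eq_finrank hfr).1 gi'⟩
  let ψ : C ≃ₗ[F] C := e.symm.trans e'
  have ψe : ∀ a ∈ A, ∀ b ∈ A, ψ (a + b * z) = σ a + σ b * σ z := by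
    intro a ha b hb
    have h1 : e (⟨a, ha⟩, ⟨b, hb⟩) = a + b * z := dmap_apply A LinearMap.id z _
    rw [← h1]
    simp only [ψ, LinearEquiv.trans_apply, LinearEquiv.symm_apply_apply]
    exact dmap_apply A σ (σ z) _
  have ψA : ∀ a ∈ A, ψ a = σ a := fun a ha => by
    have := ψe a ha 0 A.zero_mem
    simpa using this
  have ψz : ∀ a ∈ A, ψ (a * z) = ψ a * σ z := fun a ha => by
    have := ψe 0 A.zero_mem a ha
    rw [ψA a ha]
    simpa using this
  have dA := H.dbl A A1 Amul ψ.toLinearMap z hz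
    (fun a ha b hb => by
      simp only [LinearEquiv.coe_coe]
      rw [ψA a ha, ψA b hb, ψA _ (Amul a ha b hb), σAmul a ha b hb])
    (by simp only [LinearEquiv.coe_coe]; rw [ψA 1 A1, σ1])
    (fun a ha => by simp only [LinearEquiv.coe_coe]; rw [ψA a ha, σtr]) (σ z)
    (fun a ha => by simp only [LinearEquiv.coe_coe]; rw [ψA a ha, σp]; exact hz a ha) (σn z)
    ψz
  refine ⟨ψ.toLinearMap, ⟨ψ.bijective, ?_⟩, ?_, ?_⟩
  · intro a b
    obtain ⟨p, rfl⟩ := e.surjective a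
    obtain ⟨q, rfl⟩ := e.surjective b
    have he : ∀ p : A × A, e p = p.1 + p.2 * z := fun p => dmap_apply A LinearMap.id z p
    rw [he, he]
    exact (dA _ _ _ _ p.1.2 p.2.2 q.1.2 q.2.2).1
  · intro k hk
    simp only [LinearEquiv.coe_coe]
    rw [ψA k (KA k hk), σK k hk]
  · simp only [LinearEquiv.coe_coe]
    rw [ψA y yA, σy]

end CayleyAux

/-- **Lemma `le:2local_division_K`.** Let `C` be a division Cayley algebra,
`K` a 2-dimensional composition subalgebra, `x ∈ C`, and `φ` a local automorphism. Then
there is an automorphism `ψ` with `ψ|_K = φ|_K` and `ψ(x) = φ(x)`. -/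
theorem division_cayley_local_aut_agrees_on_K_and_point {F : Type*} [Field F] {C : Type*}
    [NonAssocRing C] [Module F C] [SMulCommClass F C C] [IsScalarTower F C C]
    (n : QuadraticForm F C)
    (hdim : Module.finrank F C = 8)
    (hcomp : ∀ x y : C, n (x * y) = n x * n y)
    (hnd : ∀ x : C, (∀ y : C, polar (⇑n) x y = 0) → x = 0)
    (halt : ∀ x y : C, x * (x * y) = (x * x) * y ∧ (x * y) * y = x * (y * y))
    (haniso : ∀ x : C, n x = 0 → x = 0)
    (K : Submodule F C) (hK1 : (1 : C) ∈ K)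
    (hKmul : ∀ x ∈ K, ∀ y ∈ K, x * y ∈ K)
    (hKdim : Module.finrank F ↥K = 2)
    (hKreg : ∀ x ∈ K, (∀ y ∈ K, polar (⇑n) x y = 0) → x = 0)
    (x : C)
    (φ : C →ₗ[F] C)
    (hloc : ∀ z : C, ∃ ψ : C →ₗ[F] C,
      (Function.Bijective ψ ∧ ∀ a b : C, ψ (a * b) = ψ a * ψ b) ∧ φ z = ψ z) :
    ∃ ψ : C →ₗ[F] C,
      (Function.Bijective ψ ∧ ∀ a b : C, ψ (a * b) = ψ a * ψ b) ∧
      (∀ k ∈ K, ψ k = φ k) ∧ ψ x = φ x := by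
  have hfd : FiniteDimensional F C := Module.finite_of_finrank_pos (by omega)
  have hnt : Nontrivial C := Module.nontrivial_of_finrank_pos (R := F) (by omega)
  have n1 : n 1 = 1 := by
    have h := hcomp 1 1
    rw [mul_one] at h
    have h0 : n 1 ≠ 0 := fun h => one_ne_zero (haniso _ h)
    exact (mul_left_cancel₀ h0 (by rw [mul_one]; exact h)).symm
  have H : CayleyAux.Comp n := ⟨hcomp, hnd, haniso, n1⟩
  have φ1 : φ 1 = 1 := by
    obtain ⟨ψ, ⟨hb, hm⟩, h⟩ := hloc 1
    rw [h, (H.aut_norm ψ hb hm).1]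
  have φn : ∀ x, n (φ x) = n x := by
    intro x
    obtain ⟨ψ, ⟨hb, hm⟩, h⟩ := hloc x
    rw [h, (H.aut_norm ψ hb hm).2]
  obtain ⟨k, hk, hxk⟩ := CayleyAux.exists_decomp n K hKreg x
  by_cases hy0 : x - k = 0
  · obtain ⟨y, hy0', hy⟩ := CayleyAux.exists_orth n K (by omega)
    obtain ⟨ψ, h1, h2, h3⟩ := H.main hdim K hK1 hKmul hKdim hKreg φ φ1 φn y hy0' hy
    refine ⟨ψ, h1, h2, h2 x ?_⟩
    rw [sub_eq_zero.1 hy0]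
    exact hk
  · obtain ⟨ψ, h1, h2, h3⟩ := H.main hdim K hK1 hKmul hKdim hKreg φ φ1 φn (x - k) hy0 hxk
    refine ⟨ψ, h1, h2, ?_⟩
    rw [map_sub, map_sub, h2 k hk] at h3
    exact sub_left_injective h3
end

section
/- Let C be a division Cayley algebra over a field F. Then every local automorphism of C is a 2-local automorphism, i.e. LocAut(C) = 2LocAut(C) = {φ ∈ O(C,n) : φ(1) = 1}. -/
set_option linter.all false
open QuadraticMap

/-- Working hypotheses. -/
structure CH {F : Type*} [Field F] {C : Type*} [NonAssocRing C] [Module F C]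
    (n : QuadraticForm F C) : Prop where
  comp : ∀ x y : C, n (x * y) = n x * n y
  nd : ∀ x : C, (∀ y : C, polar (⇑n) x y = 0) → x = 0
  aniso : ∀ x : C, n x = 0 → x = 0
  one : n 1 = 1

section
variable {F : Type*} [Field F] {C : Type*}
    [NonAssocRing C] [Module F C] {n : QuadraticForm F C}

theorem nadd (n : QuadraticForm F C) (x y : C) : n (x + y) = n x + n y + polar n x y := by
  simp [polar]

theorem nsmul' (n : QuadraticForm F C) (a : F) (x : C) : n (a • x) = a * a * n x := by
  simpa using QuadraticMap.map_smul n a x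

theorem pself (n : QuadraticForm F C) (x : C) : polar n x x = 2 * n x := by
  simpa using QuadraticMap.polar_self n x

theorem pcomm (n : QuadraticForm F C) (x y : C) : polar n x y = polar n y x :=
  polar_comm n x y

theorem paddl (n : QuadraticForm F C) (x y z : C) :
    polar n (x + y) z = polar n x z + polar n y z := polar_add_left n x y z
theorem paddr (n : QuadraticForm F C) (x y z : C) :
    polar n z (x + y) = polar n z x + polar n z y := polar_add_right n z x y
theorem psubl (n : QuadraticForm F C) (x y z : C) :
    polar n (x - y) z = polar n x z - polar n y z := polar_sub_left n x y z
theorem psubr (n : QuadraticForm F C) (x y z : C) :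
    polar n z (x - y) = polar n z x - polar n z y := polar_sub_right n z x y
theorem psl (n : QuadraticForm F C) (a : F) (y z : C) :
    polar n (a • y) z = a * polar n y z := by simpa using polar_smul_left n a y z
theorem psr (n : QuadraticForm F C) (a : F) (y z : C) :
    polar n y (a • z) = a * polar n y z := by simpa using polar_smul_right n a y z

namespace CH

theorem ext (h : CH n) {x y : C} (hxy : ∀ z, polar n x z = polar n y z) : x = y := by
  have := h.nd (x - y) (fun z => by rw [psubl, hxy, sub_self])
  exact sub_eq_zero.1 this

theorem pl (h : CH n) (x y z : C) : polar n (x * y) (x * z) = n x * polar n y z := by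
  have := h.comp x (y + z)
  rw [mul_add, nadd, nadd, h.comp, h.comp] at this
  linear_combination this

theorem pr (h : CH n) (x y z : C) : polar n (x * z) (y * z) = polar n x y * n z := by
  have := h.comp (x + y) z
  rw [add_mul, nadd, nadd, h.comp, h.comp] at this
  linear_combination this

theorem p4 (h : CH n) (x y z w : C) :
    polar n (x * y) (z * w) + polar n (x * w) (z * y) = polar n x z * polar n y w := by
  have := h.pl (x + z) y w
  rw [add_mul, add_mul, paddl, paddr, paddr, h.pl, h.pl, nadd, pcomm n (z * y)] at this
  linear_combination this

theorem tmul (h : CH n) (x y : C) :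
    polar n (x * y) 1 = polar n x 1 * polar n y 1 - polar n x y := by
  have := h.p4 x y 1 1
  simp only [one_mul, mul_one] at this
  linear_combination this

/-- moving left factors -/
theorem adjl (h : CH n) (x y z : C) :
    polar n (x * y) z = polar n x 1 * polar n y z - polar n y (x * z) := by
  have := h.p4 x y 1 z
  rw [one_mul, one_mul, pcomm n (x * z)] at this
  linear_combination this

theorem adjr (h : CH n) (x y z : C) :
    polar n (x * y) z = polar n y 1 * polar n x z - polar n x (z * y) := by
  have := h.p4 x y z 1
  rw [mul_one, mul_one] at this
  linear_combination this

variable [SMulCommClass F C C] [IsScalarTower F C C]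

theorem lalt (h : CH n) (x y : C) : x * (x * y) = polar n x 1 • (x * y) - n x • y := by
  apply h.ext; intro z
  rw [h.adjl, h.pl, psubl, psl, psl]

theorem ralt (h : CH n) (x y : C) : (y * x) * x = polar n x 1 • (y * x) - n x • y := by
  apply h.ext; intro z
  rw [h.adjr, h.pr, psubl, psl, psl]; ring

theorem sq (h : CH n) (x : C) : x * x = polar n x 1 • x - n x • (1 : C) := by
  have := h.lalt x 1
  rwa [mul_one] at this

theorem lalt2 (h : CH n) (x y z : C) : x * (y * z) + y * (x * z) =
    polar n x 1 • (y * z) + polar n y 1 • (x * z) - polar n x y • z := by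
  have := h.lalt (x + y) z
  rw [add_mul, add_mul, mul_add, mul_add, h.lalt, h.lalt, nadd, paddl] at this
  linear_combination (norm := module) this

theorem ralt2 (h : CH n) (x y z : C) : (z * x) * y + (z * y) * x =
    polar n x 1 • (z * y) + polar n y 1 • (z * x) - polar n x y • z := by
  have := h.ralt (x + y) z
  rw [mul_add, mul_add, add_mul, add_mul, h.ralt, h.ralt, nadd, paddl] at this
  linear_combination (norm := module) this

theorem comm2 (h : CH n) (x y : C) : x * y + y * x =
    polar n x 1 • y + polar n y 1 • x - polar n x y • (1 : C) := by
  have := h.lalt2 x y 1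
  simpa using this

end CH

/-- Pairs of compatible embeddings of an algebra. -/
structure Emb (n : QuadraticForm F C) {M : Type*} [AddCommGroup M] [Module F M]
    (p p' : M →ₗ[F] C) : Prop where
  one : ∃ e, p e = 1 ∧ p' e = 1
  mul : ∀ a b, ∃ e, p e = p a * p b ∧ p' e = p' a * p' b
  norm : ∀ a, n (p a) = n (p' a)
  nd : ∀ a, (∀ b, polar n (p a) (p b) = 0) → a = 0

variable [SMulCommClass F C C] [IsScalarTower F C C]

section
variable {M : Type*} [AddCommGroup M] [Module F M] {p p' : M →ₗ[F] C}

theorem Emb.polar (e : Emb n p p') (a b : M) :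
    QuadraticMap.polar n (p a) (p b) = QuadraticMap.polar n (p' a) (p' b) := by
  have := e.norm (a + b)
  rw [p.map_add, p'.map_add, nadd, nadd, e.norm, e.norm] at this
  linear_combination this

theorem Emb.tr (e : Emb n p p') (a : M) :
    QuadraticMap.polar n (p a) 1 = QuadraticMap.polar n (p' a) 1 := by
  obtain ⟨i, h1, h2⟩ := e.one
  have := e.polar a i
  rwa [h1, h2] at this

/-- the doubled map -/
def dbl (p : M →ₗ[F] C) (w : C) : M × M →ₗ[F] C :=
  p.coprod ((LinearMap.mulRight F w).comp p)

theorem dbl_apply (p : M →ₗ[F] C) (w : C) (z : M × M) : dbl p w z = p z.1 + p z.2 * w := by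
  simp [dbl]

theorem dmul (h : CH n) (w : C) (a b c d : C) (hw1 : QuadraticMap.polar n w 1 = 0)
    (ha : QuadraticMap.polar n w a = 0) (hc : QuadraticMap.polar n w c = 0)
    (hd : QuadraticMap.polar n w d = 0) (hb : QuadraticMap.polar n w b = 0)
    (hda : QuadraticMap.polar n w (d * a) = 0)
    (hbd : QuadraticMap.polar n w (b * d) = 0) :
    (a + b * w) * (c + d * w) =
      (a * c - n w • ((QuadraticMap.polar n d 1 • (1:C) - d) * b)) +
      (d * a + b * (QuadraticMap.polar n c 1 • (1:C) - c)) * w := by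
  have e1 : a * (d * w) = (d * a) * w := by
    have c1 := h.comm2 d w
    have c2 := h.comm2 (d * a) w
    have c3 := h.comm2 d a
    have l1 := h.lalt2 a w d
    have t1 := h.tmul d a
    rw [pcomm n d w, hd, hw1] at c1
    rw [pcomm n (d * a) w, hda, hw1] at c2
    rw [pcomm n a w, ha, hw1] at l1
    have c1' : d * w = QuadraticMap.polar n d 1 • w - w * d := by
      linear_combination (norm := module) c1
    have c3' : a * d = QuadraticMap.polar n d 1 • a + QuadraticMap.polar n a 1 • d
      - QuadraticMap.polar n d a • (1:C) - d * a := by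
      linear_combination (norm := module) c3
    have c4 := h.comm2 a w
    rw [pcomm n a w, ha, hw1] at c4
    rw [c3', mul_sub, mul_sub, mul_add] at l1
    simp only [mul_smul_comm, mul_one] at l1
    rw [c1', mul_sub, mul_smul_comm]
    rw [t1] at c2
    linear_combination (norm := module) (-1 : F) • l1 + QuadraticMap.polar n d 1 • c4 - c2
  have e2 : (b * w) * c = b * (QuadraticMap.polar n c 1 • (1:C) - c) * w := by
    have l1 := h.ralt2 w c b
    rw [hc, hw1] at l1
    rw [mul_sub, sub_mul, mul_smul_comm, mul_one, smul_mul_assoc]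
    linear_combination (norm := module) l1
  have e3 : (b * w) * (d * w) = - n w • ((QuadraticMap.polar n d 1 • (1:C) - d) * b) := by
    have l1 := h.lalt2 (b * w) d w
    have r1 := h.ralt w b
    have t1 := h.tmul b w
    rw [pcomm n b w, hb, hw1] at t1
    have t2 := h.adjr b w d
    have t3 := h.adjl b w d
    rw [hw1] at r1
    rw [t1, r1, t3, hbd, hd] at l1
    simp only [mul_sub, mul_smul_comm, zero_smul, sub_mul, smul_mul_assoc, one_mul, mul_zero, zero_sub, mul_neg] at l1 ⊢
    linear_combination (norm := module) l1
  rw [add_mul, mul_add, mul_add, e1, e2, e3, add_mul]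
  module

theorem dnorm (h : CH n) (w a b : C) (hab : ∀ x ∈ ({a, b * a, b} : Set C), QuadraticMap.polar n w x = 0) :
    n (a + b * w) = n a + n b * n w := by
  rw [nadd, h.comp, pcomm, h.adjl, hab a (by simp), hab (b * a) (by simp)]; ring

theorem Emb.pmul (e : Emb n p p') {w : C} (hw : ∀ a, QuadraticMap.polar n w (p a) = 0) (a b : M) :
    QuadraticMap.polar n w (p a * p b) = 0 := by
  obtain ⟨i, h1, h2⟩ := e.mul a b
  rw [← h1, hw]

theorem Emb.pmul' (e : Emb n p p') {w : C} (hw : ∀ a, QuadraticMap.polar n w (p' a) = 0) (a b : M) :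
    QuadraticMap.polar n w (p' a * p' b) = 0 := by
  obtain ⟨i, h1, h2⟩ := e.mul a b
  rw [← h2, hw]

theorem Emb.dbl (h : CH n) (e : Emb n p p') {w w' : C} (hw : ∀ a, QuadraticMap.polar n w (p a) = 0)
    (hw' : ∀ a, QuadraticMap.polar n w' (p' a) = 0) (hn : n w = n w') (h0 : w ≠ 0) :
    Emb n (_root_.dbl p w) (_root_.dbl p' w') := by
  obtain ⟨i, hi, hi'⟩ := e.one
  have hnorm : ∀ z, n (_root_.dbl p w z) = n (p z.1) + n (p z.2) * n w := by
    intro z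
    rw [dbl_apply]
    apply dnorm h
    rintro x (rfl | rfl | rfl)
    · exact hw _
    · exact e.pmul hw _ _
    · exact hw _
  have hnorm' : ∀ z, n (_root_.dbl p' w' z) = n (p' z.1) + n (p' z.2) * n w' := by
    intro z
    rw [dbl_apply]
    apply dnorm h
    rintro x (rfl | rfl | rfl)
    · exact hw' _
    · exact e.pmul' hw' _ _
    · exact hw' _
  refine ⟨⟨(i, 0), by simp [dbl_apply, hi], by simp [dbl_apply, hi']⟩, ?_, ?_, ?_⟩
  · rintro ⟨a, b⟩ ⟨c, d⟩
    obtain ⟨ac, h1, h1'⟩ := e.mul a c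
    obtain ⟨db, h2, h2'⟩ := e.mul (QuadraticMap.polar n (p d) 1 • i - d) b
    obtain ⟨da, h3, h3'⟩ := e.mul d a
    obtain ⟨bc, h4, h4'⟩ := e.mul b (QuadraticMap.polar n (p c) 1 • i - c)
    refine ⟨(ac - n w • db, da + bc), ?_, ?_⟩
    · rw [dbl_apply, dbl_apply, dbl_apply]
      rw [dmul h w (p a) (p b) (p c) (p d) (hi ▸ hw i) (hw _) (hw _) (hw _) (hw _)
        (e.pmul hw _ _) (e.pmul hw _ _)]
      simp only [map_sub, map_add, map_smul, h1, h2, h3, h4, hi]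
    · rw [dbl_apply, dbl_apply, dbl_apply]
      rw [dmul h w' (p' a) (p' b) (p' c) (p' d) (hi' ▸ hw' i) (hw' _) (hw' _) (hw' _) (hw' _)
        (e.pmul' hw' _ _) (e.pmul' hw' _ _)]
      simp only [map_sub, map_add, map_smul, h1', h2', h3', h4', hi', hn, e.tr]
  · intro z
    rw [hnorm, hnorm', e.norm, e.norm, hn]
  · rintro ⟨a, b⟩ hz
    have key : ∀ c d, QuadraticMap.polar n (_root_.dbl p w (a, b)) (_root_.dbl p w (c, d)) =
        QuadraticMap.polar n (p a) (p c) + QuadraticMap.polar n (p b) (p d) * n w := by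
      intro c d
      have h1 := hnorm ((a, b) + (c, d))
      rw [LinearMap.map_add, nadd, hnorm, hnorm] at h1
      simp only [Prod.mk_add_mk, map_add, nadd] at h1
      linear_combination h1
    have hw0 : n w ≠ 0 := fun h' => h0 (h.aniso _ h')
    have ha : a = 0 := e.nd a fun c => by
      have := key c 0
      rw [hz] at this
      simpa using this.symm
    have hb : b = 0 := e.nd b fun d => by
      have := key 0 d
      rw [hz] at this
      simpa [hw0] using this.symm
    rw [ha, hb]; rfl
end

/-- base map -/
def bmap (F : Type*) [Field F] {C : Type*} [NonAssocRing C] [Module F C] (u : C) : F × F →ₗ[F] C :=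
  (LinearMap.toSpanSingleton F C 1).coprod (LinearMap.toSpanSingleton F C u)

theorem bmap_apply (u : C) (z : F × F) : bmap F u z = z.1 • 1 + z.2 • u := by
  simp [bmap]

theorem bmul (h : CH n) (u : C) (a b c d : F) :
    (a • (1 : C) + b • u) * (c • 1 + d • u) =
      (a * c - b * d * n u) • (1 : C) + (a * d + b * c + b * d * polar n u 1) • u := by
  simp only [mul_add, add_mul, smul_mul_assoc, mul_smul_comm, one_mul, mul_one, h.sq]
  module

theorem bemb (h : CH n) (u u' : C) (hn : n u = n u') (ht : polar n u 1 = polar n u' 1)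
    (hd : polar n u 1 * polar n u 1 - 4 * n u ≠ 0) : Emb n (bmap F u) (bmap F u') := by
  refine ⟨⟨(1, 0), by simp [bmap_apply], by simp [bmap_apply]⟩, ?_, ?_, ?_⟩
  · rintro ⟨a, b⟩ ⟨c, d⟩
    refine ⟨(a * c - b * d * n u, a * d + b * c + b * d * polar n u 1), ?_, ?_⟩
    · simp only [bmap_apply, bmul h]
    · simp only [bmap_apply, bmul h, hn, ht]
  · rintro ⟨a, b⟩
    simp only [bmap_apply, nadd, nsmul', psl, psr, h.one, pcomm n 1, hn, ht]
  · rintro ⟨a, b⟩ hz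
    have h1 := hz (1, 0)
    have h2 := hz (0, 1)
    simp only [bmap_apply, paddl, paddr, psl, psr, pself, h.one, pcomm n 1 u] at h1 h2
    have hb : b = 0 := by
      have : b * (polar n u 1 * polar n u 1 - 4 * n u) = 0 := by
        linear_combination (polar n u 1) * h1 - 2 * h2
      simpa [hd] using this
    have ha : a = 0 := by
      have : a * (polar n u 1 * polar n u 1 - 4 * n u) = 0 := by
        linear_combination (-2 * n u) * h1 + (polar n u 1) * h2
      simpa [hd] using this
    rw [ha, hb]; rfl

theorem bperp (u : C) {w : C} (h1 : polar n w 1 = 0) (h2 : polar n w u = 0) (a : F × F) :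
    polar n w (bmap F u a) = 0 := by
  rw [bmap_apply, paddr, psr, psr, h1, h2]; simp

theorem dperp (h : CH n) (u x : C) {w : C} (h1 : polar n w 1 = 0) (h2 : polar n w u = 0)
    (h3 : polar n w x = 0) (h4 : polar n w (u * x) = 0) (a : (F × F) × (F × F)) :
    polar n w (dbl (bmap F u) x a) = 0 := by
  rw [dbl_apply, paddr, bperp u h1 h2, bmap_apply, add_mul, paddr, smul_mul_assoc, smul_mul_assoc,
    psr, psr, one_mul, h3, h4]; simp

theorem triple (h : CH n) (hdim : Module.finrank F C = 8) (u x w u' x' w' : C)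
    (hn : n u = n u') (ht : polar n u 1 = polar n u' 1)
    (hd : polar n u 1 * polar n u 1 - 4 * n u ≠ 0)
    (hx1 : polar n x 1 = 0) (hxu : polar n x u = 0)
    (hx1' : polar n x' 1 = 0) (hxu' : polar n x' u' = 0) (hnx : n x = n x') (hx0 : x ≠ 0)
    (h1 : polar n w 1 = 0) (h2 : polar n w u = 0)
    (h3 : polar n w x = 0) (h4 : polar n w (u * x) = 0)
    (h1' : polar n w' 1 = 0) (h2' : polar n w' u' = 0)
    (h3' : polar n w' x' = 0) (h4' : polar n w' (u' * x') = 0) (hnw : n w = n w') (hw0 : w ≠ 0) :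
    ∃ ψ : C →ₗ[F] C, (Function.Bijective ψ ∧ ∀ a b : C, ψ (a * b) = ψ a * ψ b) ∧
      ψ u = u' ∧ ψ x = x' ∧ ψ w = w' := by
  have : Module.Finite F C := Module.finite_of_finrank_eq_succ hdim
  have e := ((bemb h u u' hn ht hd).dbl h (bperp u hx1 hxu) (bperp u' hx1' hxu') hnx hx0).dbl h
    (dperp h u x h1 h2 h3 h4) (dperp h u' x' h1' h2' h3' h4') hnw hw0
  set q := dbl (dbl (bmap F u) x) w with hq
  set q' := dbl (dbl (bmap F u') x') w' with hq'
  have hinj : Function.Injective q := by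
    rw [injective_iff_map_eq_zero]
    intro a ha
    exact e.nd a fun b => by rw [ha]; simp
  have hinj' : Function.Injective q' := by
    rw [injective_iff_map_eq_zero]
    intro a ha
    apply hinj
    rw [map_zero]
    apply h.aniso
    rw [e.norm, ha]; simp
  have hfr : Module.finrank F (((F × F) × (F × F)) × ((F × F) × (F × F))) = Module.finrank F C := by
    rw [hdim]; simp
  let Q := LinearEquiv.ofInjectiveOfFinrankEq q hinj hfr
  have hQ : ∀ z, Q z = q z := fun z => rfl
  have hs : ∀ z, q (Q.symm z) = z := fun z => by rw [← hQ]; simp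
  have hψ : ∀ z, (q'.comp Q.symm.toLinearMap) (q z) = q' z := fun z => by
    rw [← hQ]; simp
  refine ⟨q'.comp Q.symm.toLinearMap, ⟨?_, ?_⟩, ?_, ?_, ?_⟩
  · have : Function.Injective (q'.comp Q.symm.toLinearMap) := by
      simpa using hinj'
    exact ⟨this, LinearMap.injective_iff_surjective.1 this⟩
  · intro a b
    obtain ⟨a, rfl⟩ : ∃ z, q z = a := ⟨_, hs a⟩
    obtain ⟨b, rfl⟩ : ∃ z, q z = b := ⟨_, hs b⟩
    obtain ⟨c, hc, hc'⟩ := e.mul a b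
    rw [← hc, hψ, hψ, hψ, hc']
  · have := hψ ((((0, 1), 0)), 0)
    simpa [hq, hq', dbl_apply, bmap_apply] using this
  · have := hψ (((0, (1, 0))), 0)
    simpa [hq, hq', dbl_apply, bmap_apply] using this
  · have := hψ (0, ((1, 0), 0))
    simpa [hq, hq', dbl_apply, bmap_apply] using this

/-- there is a nonzero vector orthogonal to fewer than eight given ones -/
theorem exists_perp (hdim : Module.finrank F C = 8) (k : ℕ) (hk : k < 8) (v : Fin k → C) :
    ∃ w : C, w ≠ 0 ∧ ∀ i, polar n w (v i) = 0 := by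
  have : Module.Finite F C := Module.finite_of_finrank_eq_succ hdim
  let L : C →ₗ[F] (Fin k → F) := LinearMap.pi fun i => (polarBilin n).flip (v i)
  have hL : L.ker ≠ ⊥ := LinearMap.ker_ne_bot_of_finrank_lt (by simpa [hdim] using hk)
  obtain ⟨w, hw, hw0⟩ := Submodule.exists_mem_ne_zero_of_ne_bot hL
  refine ⟨w, hw0, fun i => ?_⟩
  have := congrFun (LinearMap.mem_ker.1 hw) i
  simpa [L] using this

theorem pres (f : C ≃ₗ[F] C) (hf : ∀ x, n (f x) = n x) (x y : C) :
    polar n (f x) (f y) = polar n x y := by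
  have := hf (x + y)
  rw [f.map_add, nadd, nadd, hf, hf] at this
  linear_combination this

theorem pair (h : CH n) (hdim : Module.finrank F C = 8) (f : C ≃ₗ[F] C)
    (hf : ∀ x, n (f x) = n x) (hf1 : f 1 = 1) (u x u' x' : C)
    (hn : n u = n u') (ht : polar n u 1 = polar n u' 1)
    (hd : polar n u 1 * polar n u 1 - 4 * n u ≠ 0)
    (hx1 : polar n x 1 = 0) (hxu : polar n x u = 0)
    (hx1' : polar n x' 1 = 0) (hxu' : polar n x' u' = 0) (hnx : n x = n x') (hx0 : x ≠ 0) :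
    ∃ ψ : C →ₗ[F] C, (Function.Bijective ψ ∧ ∀ a b : C, ψ (a * b) = ψ a * ψ b) ∧
      ψ u = u' ∧ ψ x = x' := by
  obtain ⟨w, hw0, hw⟩ := exists_perp (n := n) hdim 7 (by norm_num)
    ![1, u, x, u * x, f.symm u', f.symm x', f.symm (u' * x')]
  have h' : ∀ z, polar n w (f.symm z) = 0 → polar n (f w) z = 0 := by
    intro z hz
    rw [← pres f hf, f.apply_symm_apply] at hz
    exact hz
  obtain ⟨ψ, h1, h2, h3, h4⟩ := triple h hdim u x w u' x' (f w) hn ht hd hx1 hxu hx1' hxu' hnx hx0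
    (hw 0) (hw 1) (hw 2) (hw 3) (by rw [← hf1, pres f hf]; exact hw 0) (h' _ (hw 4)) (h' _ (hw 5))
    (h' _ (hw 6)) (hf w).symm hw0
  exact ⟨ψ, h1, h2, h3⟩

theorem aut_one (h : CH n) (ψ : C →ₗ[F] C)
    (hψ : Function.Bijective ψ ∧ ∀ a b : C, ψ (a * b) = ψ a * ψ b) : ψ 1 = 1 := by
  obtain ⟨z, hz⟩ := hψ.1.2 1
  have := hψ.2 1 z
  rw [one_mul, hz, mul_one] at this
  exact this.symm

theorem aut_norm (h : CH n) (ψ : C →ₗ[F] C)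
    (hψ : Function.Bijective ψ ∧ ∀ a b : C, ψ (a * b) = ψ a * ψ b) (x : C) : n (ψ x) = n x := by
  have h1 := aut_one h ψ hψ
  by_cases hc : ∃ c : F, x = c • (1 : C)
  · obtain ⟨c, rfl⟩ := hc
    rw [ψ.map_smul, h1]
  have e1 := hψ.2 x x
  rw [h.sq, h.sq, ψ.map_sub, ψ.map_smul, ψ.map_smul, h1] at e1
  have e2 : (polar n x 1 - polar n (ψ x) 1) • ψ x = (n x - n (ψ x)) • (1 : C) := by
    linear_combination (norm := module) e1
  have h10 : (1 : C) ≠ 0 := fun h0 => by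
    have := h.one
    rw [h0] at this
    simp at this
  by_cases ht : polar n x 1 - polar n (ψ x) 1 = 0
  · rw [ht, zero_smul] at e2
    have := (smul_eq_zero.1 e2.symm).resolve_right h10
    exact (sub_eq_zero.1 this).symm
  · exfalso
    apply hc
    refine ⟨(polar n x 1 - polar n (ψ x) 1)⁻¹ * (n x - n (ψ x)), hψ.1.1 ?_⟩
    rw [ψ.map_smul, h1, mul_smul, ← e2, smul_smul, inv_mul_cancel₀ ht, one_smul]

theorem main_caseA (h : CH n) (hdim : Module.finrank F C = 8) (f : C ≃ₗ[F] C)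
    (hf : ∀ x, n (f x) = n x) (hf1 : f 1 = 1) (x y : C)
    (hy : ∀ a b : F, y ≠ a • (1 : C) + b • x)
    (hd : polar n x 1 * polar n x 1 - 4 * n x ≠ 0) :
    ∃ ψ : C →ₗ[F] C, (Function.Bijective ψ ∧ ∀ a b : C, ψ (a * b) = ψ a * ψ b) ∧
      ψ x = f x ∧ ψ y = f y := by
  set t := polar n x 1 with ht
  set d := t * t - 4 * n x with hdd
  set a := d⁻¹ * (t * polar n y x - 2 * n x * polar n y 1) with ha
  set b := d⁻¹ * (t * polar n y 1 - 2 * polar n y x) with hb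
  have p1 : ∀ z, polar n (f z) 1 = polar n z 1 := fun z => by
    have := pres f hf z 1
    rwa [hf1] at this
  have q1 : polar n (y - (a • (1 : C) + b • x)) 1 = 0 := by
    simp only [psubl, paddl, psl, pself, h.one, ← ht]
    rw [ha, hb]
    field_simp
    rw [hdd]; ring
  have q2 : polar n (y - (a • (1 : C) + b • x)) x = 0 := by
    simp only [psubl, paddl, psl, pself, pcomm n 1 x, ← ht]
    rw [ha, hb]
    field_simp
    rw [hdd]; ring
  obtain ⟨ψ, h1, h2, h3⟩ := pair h hdim f hf hf1 x (y - (a • (1 : C) + b • x)) (f x)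
    (f (y - (a • (1 : C) + b • x))) (hf x).symm (p1 x).symm hd q1 q2
    ((p1 _).trans q1) ((pres f hf _ _).trans q2) (hf _).symm (sub_ne_zero.2 (hy a b))
  refine ⟨ψ, h1, h2, ?_⟩
  simp only [map_sub, map_add, map_smul, h2, aut_one h ψ h1, hf1] at h3
  exact sub_left_injective h3

theorem indep4 (h : CH n) (x y : C) (hx : ∀ a : F, x ≠ a • (1 : C))
    (hy : ∀ a b : F, y ≠ a • (1 : C) + b • x) (htx : polar n x 1 = 0) (a b c : F) :
    1 ≠ a • x + b • y + c • (x * y) := by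
  intro he
  by_cases hc : c = 0
  · by_cases hb : b = 0
    · by_cases ha : a = 0
      · have := h.one
        rw [he, ha, hb, hc] at this
        simp at this
      · apply hx a⁻¹
        rw [he, hc, hb, zero_smul, zero_smul, add_zero, add_zero, smul_smul, inv_mul_cancel₀ ha,
          one_smul]
    · apply hy (b⁻¹) (-b⁻¹ * a)
      rw [he, hc]
      simp only [smul_add, smul_smul, inv_mul_cancel₀ hb]
      module
  · have hs : b • (1 : C) + c • x ≠ 0 := by
      intro h0
      apply hx (- c⁻¹ * b)
      have : x = c⁻¹ • (c • x) := by rw [smul_smul, inv_mul_cancel₀ hc, one_smul]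
      rw [this]
      have h1 : c • x = - (b • (1:C)) := by linear_combination (norm := module) h0
      rw [h1]; module
    have hns : n (b • (1 : C) + c • x) ≠ 0 := fun h0 => hs (h.aniso _ h0)
    rw [nadd, nsmul', nsmul', psl, psr, pcomm n 1 x, htx, h.one] at hns
    set s := b * b * 1 + c * c * n x + b * (c * 0) with hsd
    have e1 : (b • (1 : C) - c • x) * 1 = (b • (1 : C) - c • x) * (a • x + b • y + c • (x * y)) := by
      rw [← he]
    have hxx := h.sq x
    have hxy := h.lalt x y
    rw [htx] at hxx hxy
    simp only [sub_mul, mul_add, smul_mul_assoc, mul_smul_comm, one_mul, mul_one, hxx, hxy] at e1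
    have e2 : s • y = (b - a * c * n x) • (1 : C) + (- c - a * b) • x := by
      rw [hsd]
      linear_combination (norm := module) -e1
    apply hy (s⁻¹ * (b - a * c * n x)) (s⁻¹ * (- c - a * b))
    rw [mul_smul, mul_smul, ← smul_add, ← e2, smul_smul, inv_mul_cancel₀ hns, one_smul]

theorem main_caseB (h : CH n) (hdim : Module.finrank F C = 8) (f : C ≃ₗ[F] C)
    (hf : ∀ x, n (f x) = n x) (hf1 : f 1 = 1) (x y : C) (hx : ∀ a : F, x ≠ a • (1 : C))
    (hy : ∀ a b : F, y ≠ a • (1 : C) + b • x)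
    (h20 : (2 : F) = 0) (htx : polar n x 1 = 0) (hty : polar n y 1 = 0) :
    ∃ ψ : C →ₗ[F] C, (Function.Bijective ψ ∧ ∀ a b : C, ψ (a * b) = ψ a * ψ b) ∧
      ψ x = f x ∧ ψ y = f y := by
  have p1 : ∀ z, polar n (f z) 1 = polar n z 1 := fun z => by
    have := pres f hf z 1
    rwa [hf1] at this
  have hx0 : x ≠ 0 := fun h0 => hx 0 (by rw [h0, zero_smul])
  have hy0 : y ≠ 0 := fun h0 => hy 0 0 (by rw [h0, zero_smul, zero_smul, add_zero])
  have hnx : n x ≠ 0 := fun h0 => hx0 (h.aniso _ h0)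
  have h40 : (4 : F) = 0 := by linear_combination 2 * h20
  have pxx : ∀ z : C, polar n z z = 0 := fun z => by rw [pself, h20, zero_mul]
  have pxy : ∀ x y : C, polar n x 1 = 0 → polar n y 1 = 0 → polar n (x * y) x = 0 := by
    intro x y hx hy
    have := h.pl x y 1
    rwa [mul_one, hy, mul_zero] at this
  by_cases hxy : polar n x y = 0
  · have hxy' : polar n (f x) (f y) = 0 := by rw [pres f hf, hxy]
    have pxyy : polar n (x * y) y = 0 := by
      have := h.pr x 1 y
      rwa [one_mul, htx, zero_mul] at this
    have txy : polar n (x * y) 1 = 0 := by rw [h.tmul, htx, hty, hxy]; ring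
    set z := f.symm (f x * f y) with hz
    have hnz : n z = n (x * y) := by
      rw [← hf z, hz, f.apply_symm_apply, h.comp, hf, hf, h.comp]
    obtain ⟨v, hv1, hv⟩ : ∃ v : C, polar n v 1 ≠ 0 ∧ ∀ i, polar n v ((![x, y, x * y, z]) i) = 0 := by
      by_contra hcon
      push Not at hcon
      have hmem : polarBilin n 1 ∈
          Submodule.span F (Set.range fun i => polarBilin n ((![x, y, x * y, z]) i)) := by
        apply mem_span_of_iInf_ker_le_ker
        intro v hv
        rw [LinearMap.mem_ker]
        by_contra hv1
        obtain ⟨i, hi⟩ := hcon v (by rw [pcomm]; exact hv1)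
        apply hi
        rw [Submodule.mem_iInf] at hv
        rw [pcomm]
        exact LinearMap.mem_ker.1 (hv i)
      obtain ⟨c, hc⟩ := (Submodule.mem_span_range_iff_exists_fun F).1 hmem
      simp only [Fin.sum_univ_four] at hc
      have h1 : (1 : C) = c 0 • x + c 1 • y + c 2 • (x * y) + c 3 • z := by
        apply h.ext
        intro v
        have := LinearMap.congr_fun hc v
        simp only [paddl, psl]
        simpa using this.symm
      have h2 : c 3 • z = 1 + ((- c 0) • x + (- c 1) • y + (- c 2) • (x * y)) := by
        linear_combination (norm := module) -h1
      have h3 := congrArg n h2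
      rw [nsmul', hnz] at h3
      have h4 : n (1 + ((- c 0) • x + (- c 1) • y + (- c 2 - c 3) • (x * y))) = 0 := by
        simp only [nadd, nsmul', paddl, paddr, psl, psr, pcomm n 1, htx, hty, txy, hxy,
          pcomm n x (x * y), pcomm n y (x * y), pxyy, pxy x y htx hty] at h3 ⊢
        linear_combination -h3 + (c 3 * c 3 + c 2 * c 3) * n (x * y) * h20
      have h5 := h.aniso _ h4
      apply indep4 h x y hx hy htx (c 0) (c 1) (c 2 + c 3)
      linear_combination (norm := module) h5
    set u := (polar n v 1)⁻¹ • v with hu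
    have hut : polar n u 1 = 1 := by rw [hu, psl, inv_mul_cancel₀ hv1]
    have hux : polar n u x = 0 := by rw [hu, psl]; erw [hv 0]; rw [mul_zero]
    have huy : polar n u y = 0 := by rw [hu, psl]; erw [hv 1]; rw [mul_zero]
    have huxy : polar n u (x * y) = 0 := by rw [hu, psl]; erw [hv 2]; rw [mul_zero]
    have huz : polar n u z = 0 := by rw [hu, psl]; erw [hv 3]; rw [mul_zero]
    have huz' : polar n (f u) (f x * f y) = 0 := by
      rw [← pres f hf, hz, f.apply_symm_apply] at huz
      exact huz
    have key : ∀ u x y : C, polar n x 1 = 0 → polar n y 1 = 0 → polar n x y = 0 →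
        polar n u (x * y) = 0 → polar n y (u * x) = 0 := by
      intro u x y h1 h2 h3 h4
      have c := h.comm2 x y
      rw [h1, h2, h3] at c
      have c' : y * x = - (x * y) := by linear_combination (norm := module) c
      rw [pcomm, h.adjr, h1, c', polar_neg_right, h4]; ring
    obtain ⟨ψ, h1, h2, h3, h4⟩ := triple h hdim u x y (f u) (f x) (f y) (hf u).symm (p1 u).symm
      (by rw [hut, h40]; simp) htx (by rw [pcomm]; exact hux) (by rw [p1]; exact htx)
      (by rw [pres f hf, pcomm]; exact hux) (hf x).symm hx0 hty (by rw [pcomm]; exact huy)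
      (by rw [pcomm]; exact hxy) (key u x y htx hty hxy huxy)
      (by rw [p1]; exact hty) (by rw [pres f hf, pcomm]; exact huy)
      (by rw [pcomm]; exact hxy') (key _ _ _ (by rw [p1]; exact htx) (by rw [p1]; exact hty)
        hxy' huz') (hf y).symm hy0
    exact ⟨ψ, h1, h3, h4⟩
  · have t : ∀ x y : C, polar n x 1 = 0 → polar n y 1 = 0 →
      polar n (x * y) 1 = - polar n x y := by
      intro x y h1 h2
      rw [h.tmul, h1, h2]; ring
    have htx' : polar n (f x) 1 = 0 := by rw [p1, htx]
    have hty' : polar n (f y) 1 = 0 := by rw [p1, hty]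
    obtain ⟨ψ, h1, h2, h3⟩ := pair h hdim f hf hf1 (x * y) x (f x * f y) (f x)
      (by rw [h.comp, h.comp, hf, hf])
      (by rw [t _ _ htx hty, t _ _ htx' hty', pres f hf])
      (by rw [t _ _ htx hty, h40]; simpa using hxy)
      htx (by rw [pcomm]; exact pxy _ _ htx hty) htx' (by rw [pcomm]; exact pxy _ _ htx' hty')
      (hf x).symm hx0
    refine ⟨ψ, h1, h3, ?_⟩
    rw [h1.2, h3] at h2
    have h4 : f x * (ψ y - f y) = 0 := by rw [mul_sub, h2, sub_self]
    have h5 := h.comp (f x) (ψ y - f y)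
    rw [h4, hf] at h5
    have h6 : n (ψ y - f y) = 0 := by simpa [hnx] using h5.symm
    exact sub_eq_zero.1 (h.aniso _ h6)

theorem main_indep (h : CH n) (hdim : Module.finrank F C = 8) (f : C ≃ₗ[F] C)
    (hf : ∀ x, n (f x) = n x) (hf1 : f 1 = 1) (x y : C) (hx : ∀ a : F, x ≠ a • (1 : C))
    (hy : ∀ a b : F, y ≠ a • (1 : C) + b • x) :
    ∃ ψ : C →ₗ[F] C, (Function.Bijective ψ ∧ ∀ a b : C, ψ (a * b) = ψ a * ψ b) ∧
      ψ x = f x ∧ ψ y = f y := by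
  by_cases hdx : polar n x 1 * polar n x 1 - 4 * n x = 0
  swap
  · exact main_caseA h hdim f hf hf1 x y hy hdx
  by_cases hdy : polar n y 1 * polar n y 1 - 4 * n y = 0
  swap
  · obtain ⟨ψ, h1, h2, h3⟩ := main_caseA h hdim f hf hf1 y x (by
      intro a b hab
      by_cases hb : b = 0
      · exact hx a (by rw [hab, hb]; module)
      · apply hy (- b⁻¹ * a) (b⁻¹)
        have : b⁻¹ • (b • y) = y := by rw [smul_smul, inv_mul_cancel₀ hb, one_smul]
        rw [hab, smul_add, this]
        module) hdy
    exact ⟨ψ, h1, h3, h2⟩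
  have h20 : (2 : F) = 0 := by
    by_contra h2
    have h3 : n ((2 : F) • x + (- polar n x 1) • (1 : C)) = 0 := by
      rw [nadd, nsmul', nsmul', psl, psr, h.one]
      linear_combination -hdx
    have h4 := h.aniso _ h3
    apply hx (2⁻¹ * polar n x 1)
    have : (2 : F)⁻¹ • ((2 : F) • x) = x := by rw [smul_smul, inv_mul_cancel₀ h2, one_smul]
    have h5 : (2 : F) • x = polar n x 1 • (1 : C) := by linear_combination (norm := module) h4
    rw [mul_smul, ← h5, this]
  have h40 : (4 : F) = 0 := by linear_combination 2 * h20
  rw [h40] at hdx hdy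
  exact main_caseB h hdim f hf hf1 x y hx hy h20 (by simpa using hdx) (by simpa using hdy)

theorem exists_not_span (hdim : Module.finrank F C = 8) (x : C) :
    ∃ y : C, ∀ a b : F, y ≠ a • (1 : C) + b • x := by
  have : Module.Finite F C := Module.finite_of_finrank_eq_succ hdim
  by_contra hcon
  push Not at hcon
  have hs : Function.Surjective (bmap F x) := by
    intro y
    obtain ⟨a, b, hab⟩ := hcon y
    exact ⟨(a, b), by rw [bmap_apply, hab]⟩
  have := LinearMap.finrank_le_finrank_of_surjective hs
  rw [hdim] at this
  simp at this

theorem main_two (h : CH n) (hdim : Module.finrank F C = 8) (f : C ≃ₗ[F] C)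
    (hf : ∀ x, n (f x) = n x) (hf1 : f 1 = 1) (x y : C) :
    ∃ ψ : C →ₗ[F] C, (Function.Bijective ψ ∧ ∀ a b : C, ψ (a * b) = ψ a * ψ b) ∧
      f x = ψ x ∧ f y = ψ y := by
  have step : ∀ x y : C, (∀ a : F, x ≠ a • (1 : C)) → 
    ∃ ψ : C →ₗ[F] C, (Function.Bijective ψ ∧ ∀ a b : C, ψ (a * b) = ψ a * ψ b) ∧
      f x = ψ x ∧ f y = ψ y := by
    intro x y hx
    by_cases hy : ∀ a b : F, y ≠ a • (1 : C) + b • x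
    · obtain ⟨ψ, h1, h2, h3⟩ := main_indep h hdim f hf hf1 x y hx hy
      exact ⟨ψ, h1, h2.symm, h3.symm⟩
    · push Not at hy
      obtain ⟨a, b, rfl⟩ := hy
      obtain ⟨z, hz⟩ := exists_not_span hdim x
      obtain ⟨ψ, h1, h2, h3⟩ := main_indep h hdim f hf hf1 x z hx hz
      refine ⟨ψ, h1, h2.symm, ?_⟩
      simp only [map_add, map_smul, aut_one h ψ h1, h2, hf1]
  by_cases hx : ∀ a : F, x ≠ a • (1 : C)
  · exact step x y hx
  · push Not at hx
    obtain ⟨a, rfl⟩ := hx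
    by_cases hy : ∀ a : F, y ≠ a • (1 : C)
    · obtain ⟨ψ, h1, h2, h3⟩ := step y y hy
      refine ⟨ψ, h1, ?_, h2⟩
      simp only [map_smul, aut_one h ψ h1, hf1]
    · push Not at hy
      obtain ⟨b, rfl⟩ := hy
      refine ⟨LinearMap.id, ⟨Function.bijective_id, fun _ _ => rfl⟩, ?_, ?_⟩ <;> simp [hf1]

theorem two_linear (h : CH n) (hdim : Module.finrank F C = 8) (φ : C → C)
    (hφ : ∀ x y : C, ∃ ψ : C →ₗ[F] C,
        (Function.Bijective ψ ∧ ∀ a b : C, ψ (a * b) = ψ a * ψ b) ∧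
        φ x = ψ x ∧ φ y = ψ y) : IsLinearMap F φ := by
  have : Module.Finite F C := Module.finite_of_finrank_eq_succ hdim
  have hp : ∀ x y, polar n (φ x) (φ y) = polar n x y := by
    intro x y
    obtain ⟨ψ, h1, h2, h3⟩ := hφ x y
    rw [h2, h3, polar, ← map_add, aut_norm h ψ h1, aut_norm h ψ h1, aut_norm h ψ h1, polar]
  let b := Module.finBasisOfFinrankEq F C hdim
  let g : C →ₗ[F] C := b.constr F (fun i => φ (b i))
  have hg : ∀ i, g (b i) = φ (b i) := fun i => b.constr_basis F _ i
  have hgp : ∀ x y, polar n (g x) (φ y) = polar n x y := by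
    intro x y
    have : (polarBilin n).flip (φ y) ∘ₗ g = (polarBilin n).flip y := by
      apply b.ext
      intro i
      simp only [LinearMap.comp_apply, hg]
      simpa using hp (b i) y
    simpa using LinearMap.congr_fun this x
  have ginj : Function.Injective g := by
    rw [injective_iff_map_eq_zero]
    intro x hx
    apply h.nd
    intro y
    rw [← hgp, hx]; simp
  have gsurj := LinearMap.injective_iff_surjective.1 ginj
  have hgg : ∀ x y, polar n (φ x) (g y) = polar n x y := fun x y => by rw [pcomm, hgp, pcomm]
  have heq : ∀ x z, polar n (φ x) z = polar n (g x) z := by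
    have hgg2 : ∀ x y, polar n (g x) (g y) = polar n x y := by
      intro x y
      have : polarBilin n (g x) ∘ₗ g = polarBilin n x := by
        apply b.ext
        intro i
        simp only [LinearMap.comp_apply, hg]
        simpa using hgp x (b i)
      simpa using LinearMap.congr_fun this y
    intro x z
    obtain ⟨y, rfl⟩ := gsurj z
    rw [hgg, hgg2]
  have : φ = g := funext fun x => h.ext (heq x)
  rw [this]
  exact g.isLinear

end

/-- **Theorem `th:2localautos_division_not2`.** For a division Cayley algebra
`C`, the local and 2-local automorphisms coincide, and both coincide with
`{φ ∈ O(C,n) : φ(1) = 1}`. -/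
theorem division_cayley_local_eq_two_local {F : Type*} [Field F] {C : Type*}
    [NonAssocRing C] [Module F C] [SMulCommClass F C C] [IsScalarTower F C C]
    (n : QuadraticForm F C)
    (hdim : Module.finrank F C = 8)
    (hcomp : ∀ x y : C, n (x * y) = n x * n y)
    (hnd : ∀ x : C, (∀ y : C, polar (⇑n) x y = 0) → x = 0)
    (halt : ∀ x y : C, x * (x * y) = (x * x) * y ∧ (x * y) * y = x * (y * y))
    (haniso : ∀ x : C, n x = 0 → x = 0)
    (φ : C → C) :
    ((IsLinearMap F φ ∧ ∀ x : C, ∃ ψ : C →ₗ[F] C,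
        (Function.Bijective ψ ∧ ∀ a b : C, ψ (a * b) = ψ a * ψ b) ∧ φ x = ψ x) ↔
      (∀ x y : C, ∃ ψ : C →ₗ[F] C,
        (Function.Bijective ψ ∧ ∀ a b : C, ψ (a * b) = ψ a * ψ b) ∧
        φ x = ψ x ∧ φ y = ψ y)) ∧
    ((IsLinearMap F φ ∧ ∀ x : C, ∃ ψ : C →ₗ[F] C,
        (Function.Bijective ψ ∧ ∀ a b : C, ψ (a * b) = ψ a * ψ b) ∧ φ x = ψ x) ↔
      (IsLinearMap F φ ∧ Function.Bijective φ ∧ (∀ x : C, n (φ x) = n x) ∧ φ 1 = 1)) := by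
  have hfin : Module.Finite F C := Module.finite_of_finrank_eq_succ hdim
  have h10 : (1 : C) ≠ 0 := by
    intro h0
    have : Subsingleton C := ⟨fun a b => by rw [← mul_one a, ← mul_one b, h0, mul_zero, mul_zero]⟩
    rw [Module.finrank_zero_of_subsingleton] at hdim
    omega
  have hn1 : n 1 = 1 := by
    have h1 := hcomp 1 1
    rw [one_mul] at h1
    have h2 : n 1 ≠ 0 := fun h' => h10 (haniso _ h')
    exact (mul_left_cancel₀ h2 (by rw [mul_one]; exact h1)).symm
  have h : CH n := ⟨hcomp, hnd, haniso, hn1⟩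
  have A : (IsLinearMap F φ ∧ ∀ x : C, ∃ ψ : C →ₗ[F] C,
        (Function.Bijective ψ ∧ ∀ a b : C, ψ (a * b) = ψ a * ψ b) ∧ φ x = ψ x) →
      (IsLinearMap F φ ∧ Function.Bijective φ ∧ (∀ x : C, n (φ x) = n x) ∧ φ 1 = 1) := by
    rintro ⟨hl, hloc⟩
    have hnorm : ∀ x, n (φ x) = n x := by
      intro x
      obtain ⟨ψ, h1, h2⟩ := hloc x
      rw [h2, aut_norm h ψ h1]
    have hinj : Function.Injective (hl.mk' φ) := by
      rw [injective_iff_map_eq_zero]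
      intro x hx
      apply haniso
      rw [← hnorm]
      have : φ x = 0 := hx
      rw [this]; simp
    refine ⟨hl, ⟨hinj, LinearMap.injective_iff_surjective.1 hinj⟩, hnorm, ?_⟩
    obtain ⟨ψ, h1, h2⟩ := hloc 1
    rw [h2, aut_one h ψ h1]
  have B : (IsLinearMap F φ ∧ Function.Bijective φ ∧ (∀ x : C, n (φ x) = n x) ∧ φ 1 = 1) →
      (∀ x y : C, ∃ ψ : C →ₗ[F] C,
        (Function.Bijective ψ ∧ ∀ a b : C, ψ (a * b) = ψ a * ψ b) ∧
        φ x = ψ x ∧ φ y = ψ y) := by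
    rintro ⟨hl, hb, hnorm, h1⟩
    exact main_two h hdim (LinearEquiv.ofBijective (hl.mk' φ) hb) hnorm h1
  refine ⟨⟨fun hloc => B (A hloc), fun h2 => ⟨two_linear h hdim φ h2, fun x => ?_⟩⟩,
    ⟨A, fun h3 => ⟨h3.1, fun x => ?_⟩⟩⟩
  · obtain ⟨ψ, h1, h2, _⟩ := h2 x x
    exact ⟨ψ, h1, h2⟩
  · obtain ⟨ψ, h1, h2, _⟩ := B h3 x x
    exact ⟨ψ, h1, h2⟩
end
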